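/- Let R = R_{n,e,P,Q}. Every nonzero locally nilpotent k-derivation D of R maps the subalgebra k[x,s,y] (which is isomorphic to the Danielewski domain B_{n,P}) into itself and restricts to a nonzero locally nilpotent derivation of it; likewise D maps the subalgebra k[x,s] into itself and restricts to a nonzero locally nilpotent derivation of k[x,s]. -/

import Mathlib

open MvPolynomial

/-- A locally nilpotent `k`-derivation. -/
def IsLND {k B : Type*} [CommRing k] [CommRing B] [Algebra k B]
    (D : Derivation k B B) : Prop :=
  ∀ a : B, ∃ n : ℕ, ((D.toLinearMap : Module.End k B) ^ n) a = 0

noncomputable section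

variable (k : Type*) [Field k] [CharZero k]

/-- `P(X,T) = T^d + f_{d-1}(X) T^{d-1} + ⋯ + f_0(X)` evaluated at `T`, inside `k[X,Y,Z]`
(the variable `X` has index 0). -/
def Pat (d : ℕ) (f : ℕ → Polynomial k) (T : MvPolynomial (Fin 3) k) :
    MvPolynomial (Fin 3) k :=
  T ^ d + ∑ i ∈ Finset.range d, Polynomial.aeval (X 0) (f i) * T ^ i

/-- `Q(X,Y) = Y^m + g_{m-1}(X) Y^{m-1} + ⋯ + g_0(X)` in `k[X,Y,Z]`
(variables `X = 0`, `Y = 1`, `Z = 2`). -/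
def Qpoly (m : ℕ) (g : ℕ → Polynomial k) : MvPolynomial (Fin 3) k :=
  X 1 ^ m + ∑ j ∈ Finset.range m, Polynomial.aeval (X 0) (g j) * X 1 ^ j

/-- The ideal `⟨XⁿY - P(X, Q(X,Y) - XᵉZ)⟩` of `k[X,Y,Z]` (variables `X = 0`, `Y = 1`, `Z = 2`). -/
def RIdeal (n e d m : ℕ) (f g : ℕ → Polynomial k) : Ideal (MvPolynomial (Fin 3) k) :=
  Ideal.span {X 0 ^ n * X 1 - Pat k d f (Qpoly k m g - X 0 ^ e * X 2)}

/-- `R_{n,e,P,Q} = k[X,Y,Z]/⟨XⁿY - P(X, Q(X,Y) - XᵉZ)⟩`. -/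
def RRing (n e d m : ℕ) (f g : ℕ → Polynomial k) : Type _ :=
  MvPolynomial (Fin 3) k ⧸ RIdeal k n e d m f g

instance (n e d m : ℕ) (f g : ℕ → Polynomial k) : CommRing (RRing k n e d m f g) :=
  Ideal.Quotient.commRing _

instance (n e d m : ℕ) (f g : ℕ → Polynomial k) : Algebra k (RRing k n e d m f g) :=
  Ideal.Quotient.algebra k

variable (n e d m : ℕ) (f g : ℕ → Polynomial k)

/-- The class `x` of `X` in `R_{n,e,P,Q}`. -/
def xel : RRing k n e d m f g := Ideal.Quotient.mk _ (X 0)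

/-- The class `y` of `Y` in `R_{n,e,P,Q}`. -/
def yel : RRing k n e d m f g := Ideal.Quotient.mk _ (X 1)

/-- The class `z` of `Z` in `R_{n,e,P,Q}`. -/
def zel : RRing k n e d m f g := Ideal.Quotient.mk _ (X 2)

/-- The element `s = Q(x,y) - xᵉz` of `R_{n,e,P,Q}`. -/
def sel : RRing k n e d m f g := Ideal.Quotient.mk _ (Qpoly k m g - X 0 ^ e * X 2)

/-- `(∂P/∂S)(x,s)` in `R_{n,e,P,Q}`. -/
def PSel : RRing k n e d m f g :=
  (d : RRing k n e d m f g) * sel k n e d m f g ^ (d - 1) +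
    ∑ i ∈ Finset.range d, (i : RRing k n e d m f g) *
      Polynomial.aeval (xel k n e d m f g) (f i) * sel k n e d m f g ^ (i - 1)

/-- `(∂Q/∂Y)(x,y)` in `R_{n,e,P,Q}`. -/
def QYel : RRing k n e d m f g :=
  (m : RRing k n e d m f g) * yel k n e d m f g ^ (m - 1) +
    ∑ j ∈ Finset.range m, (j : RRing k n e d m f g) *
      Polynomial.aeval (xel k n e d m f g) (g j) * yel k n e d m f g ^ (j - 1)

end

noncomputable section

variable (k : Type*) [Field k] [CharZero k]

/-- The ideal `⟨XⁿY - P(X,S)⟩` of `k[X,S,Y]` (variables `X = 0`, `S = 1`, `Y = 2`). -/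
def DanIdeal (n d : ℕ) (f : ℕ → Polynomial k) : Ideal (MvPolynomial (Fin 3) k) :=
  Ideal.span {X 0 ^ n * X 2 - Pat k d f (X 1)}

/-- The Danielewski domain `B_{n,P} = k[X,S,Y]/⟨XⁿY - P(X,S)⟩`. -/
def DanRing (n d : ℕ) (f : ℕ → Polynomial k) : Type _ :=
  MvPolynomial (Fin 3) k ⧸ DanIdeal k n d f

instance (n d : ℕ) (f : ℕ → Polynomial k) : CommRing (DanRing k n d f) :=
  Ideal.Quotient.commRing _

instance (n d : ℕ) (f : ℕ → Polynomial k) : Algebra k (DanRing k n d f) :=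
  Ideal.Quotient.algebra k

end

set_option maxHeartbeats 1000000 in
/-- Arithmetic of the possible degrees of a homogeneous locally nilpotent derivation of the
monomial algebra with exponents `(i - n⌊j/d⌋ - e⌊j/(dm)⌋, j)`. -/
theorem homogeneous_degree_restriction {n e d m : ℕ} (hn : 1 ≤ n) (hne : ¬(n = 1 ∧ e = 0))
    (hd : 2 ≤ d) (hm : 2 ≤ m) {M : ℤ × ℤ → Prop}
    (hM : ∀ u, M u → ∃ j : ℕ, u.2 = j ∧ -((n * (j / d) + e * (j / (d * m)) : ℕ) : ℤ) ≤ u.1)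
    {a b p q : ℤ} (ha : 0 ≤ a) (hb : 0 ≤ b) (hdeg : b * q + 1 = a * p)
    (hc : 0 ≤ d * b - n * a) (hr : 0 ≤ d * m * b - (n * m + e) * a)
    (hX : a ≠ 0 → M (1 - p, q)) (hS : b ≠ 0 → M (-p, q + 1))
    (hY : d * b - n * a ≠ 0 → M (-p - n, q + d))
    (hZ : d * m * b - (n * m + e) * a ≠ 0 → M (-p - (n * m + e), q + d * m)) :
    a = 0 ∧ q = -1 ∧ p ≤ -n := by
  have hd0 : 0 < d := by omega
  have hm0 : 0 < m := by omega
  have ha0 : a = 0 := by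
    by_contra hane
    have hapos : 0 < a := lt_of_le_of_ne ha (Ne.symm hane)
    have hbne : b ≠ 0 := by
      rintro rfl
      have : (0 : ℤ) < n * a := by positivity
      simp at hc; omega
    have hφ : ∀ j : ℕ, (d * m * ((n * (j / d) + e * (j / (d * m)) : ℕ) : ℤ)) ≤ (n * m + e) * j := by
      intro j
      have h1 : d * (j / d) ≤ j := Nat.mul_div_le j d
      have h2 : d * m * (j / (d * m)) ≤ j := Nat.mul_div_le j (d * m)
      have h3 : n * m * (d * (j / d)) ≤ n * m * j := Nat.mul_le_mul_left _ h1
      have h4 : e * (d * m * (j / (d * m))) ≤ e * j := Nat.mul_le_mul_left _ h2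
      have : d * m * (n * (j / d) + e * (j / (d * m))) ≤ (n * m + e) * j := by
        calc _ = n * m * (d * (j / d)) + e * (d * m * (j / (d * m))) := by ring
          _ ≤ _ := by linarith [add_mul (n * m) e j]
      exact_mod_cast this
    obtain ⟨q', hq', hX'⟩ := hM _ (hX hane)
    obtain ⟨j1, hj1, hS'⟩ := hM _ (hS hbne)
    simp only at hq' hX' hj1 hS'
    subst hq'
    have : j1 = q' + 1 := by exact_mod_cast hj1.symm
    subst this
    have hr0 : d * m * b = (n * m + e) * a := by
      by_contra hne'
      obtain ⟨j, hj, hZ'⟩ := hM _ (hZ (sub_ne_zero.2 hne'))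
      simp only at hj hZ'
      have := hφ j
      rw [← hj] at this
      generalize ((n * (j / d) + e * (j / (d * m)) : ℕ) : ℤ) = w at this hZ'
      have h1 : (d * m : ℤ) * p ≤ (n * m + e) * q' := by
        linarith [mul_le_mul_of_nonneg_left hZ' (show (0 : ℤ) ≤ d * m by positivity)]
      nlinarith
    have hdm : (0 : ℤ) < d * m := by positivity
    have hkey : ((n * m + e) * q' : ℤ) < d * m * p := by
      by_contra h
      push Not at h
      nlinarith
    have hq1 : (q' + 1) % d = 0 := by
      by_contra h
      have h1 : (q' + 1) / d = q' / d := by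
        rw [Nat.succ_div_of_not_dvd (by rwa [Nat.dvd_iff_mod_eq_zero])]
      have h2 : (q' + 1) / (d * m) = q' / (d * m) := by
        rw [← Nat.div_div_eq_div_mul, ← Nat.div_div_eq_div_mul, h1]
      rw [h1, h2] at hS'
      have := hφ q'
      nlinarith
    obtain ⟨t, ht⟩ := Nat.dvd_of_mod_eq_zero hq1
    have ht0 : t ≠ 0 := by rintro rfl; omega
    obtain ⟨t, rfl⟩ := Nat.exists_eq_succ_of_ne_zero ht0
    have hqd : q' = d * t + (d - 1) := by rw [Nat.mul_succ] at ht; omega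
    have hdiv : q' / d = t := by
      rw [hqd, Nat.mul_add_div hd0, Nat.div_eq_of_lt (by omega), add_zero]
    rw [← Nat.div_div_eq_div_mul, hdiv] at hX'
    have hqz : (q' : ℤ) = d * t + d - 1 := by
      have : q' + 1 = d * t + d := by rw [Nat.mul_succ] at ht; omega
      have : (q' : ℤ) + 1 = d * t + d := by exact_mod_cast this
      linarith
    have hnz : (1 : ℤ) ≤ n := by exact_mod_cast hn
    have hdz : (2 : ℤ) ≤ d := by exact_mod_cast hd
    have hmz : (2 : ℤ) ≤ m := by exact_mod_cast hm
    have htz : (0 : ℤ) ≤ t := by positivity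
    rcases Nat.eq_zero_or_pos e with he | he
    · subst he
      have hn2 : (2 : ℤ) ≤ n := by
        have : 2 ≤ n := by omega
        exact_mod_cast this
      push_cast at hX' hkey
      have h1 : (d : ℤ) * p > n * q' := by
        by_contra h
        push Not at h
        nlinarith
      have h2 : p ≤ n * t + 1 := by linarith
      rw [hqz] at h1
      nlinarith
    · have hez : (1 : ℤ) ≤ e := by exact_mod_cast he
      have hcne : (d * b - n * a : ℤ) ≠ 0 := by
        intro h
        have : (e : ℤ) * a = 0 := by linear_combination (m : ℤ) * h - hr0
        rcases mul_eq_zero.1 this with h | h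
        · omega
        · exact hane h
      obtain ⟨j, hj, hY'⟩ := hM _ (hY hcne)
      simp only at hj hY'
      have hj' : j = d * (t + 1) + (d - 1) := by
        have : j = q' + d := by exact_mod_cast hj.symm
        rw [this, hqd]; ring
      have hjdiv : j / d = t + 1 := by
        rw [hj', Nat.mul_add_div hd0, Nat.div_eq_of_lt (by omega), add_zero]
      rw [← Nat.div_div_eq_div_mul, hjdiv] at hY'
      by_cases hmt : m ∣ t + 1
      · obtain ⟨v, hv⟩ := hmt
        have hv0 : v ≠ 0 := by rintro rfl; omega
        obtain ⟨v, rfl⟩ := Nat.exists_eq_succ_of_ne_zero hv0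
        have htm : t / m = v := by
          have : t = m * v + (m - 1) := by rw [Nat.mul_succ] at hv; omega
          rw [this, Nat.mul_add_div hm0, Nat.div_eq_of_lt (by omega), add_zero]
        rw [htm] at hX'
        push_cast at hX'
        have hvz : (t : ℤ) + 1 = m * v + m := by
          have : t + 1 = m * v + m := by rw [← Nat.mul_succ]; exact hv
          exact_mod_cast this
        have hv1 : (d : ℤ) * m * p ≤ d * m * (n * t + e * v + 1) := by
          apply mul_le_mul_of_nonneg_left _ hdm.le; linarith
        rw [hqz] at hkey
        have e1 : (m : ℤ) * v = t + 1 - m := by linarith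
        have h5 : (d : ℤ) * m * (n * t + e * v + 1) = d * m * n * t + d * e * (t + 1 - m) + d * m := by
          rw [← e1]; ring
        rw [h5] at hv1
        have h6 : (d : ℤ) * m * (n + e - 1) < n * m + e := by linarith
        have h7 : (2 * m : ℤ) ≤ d * m := mul_le_mul_of_nonneg_right hdz (by positivity)
        have h8 : (2 * m : ℤ) * (n + e - 1) ≤ d * m * (n + e - 1) :=
          mul_le_mul_of_nonneg_right h7 (by linarith)
        have h9 : (m : ℤ) ≤ m * n := le_mul_of_one_le_right (by positivity) hnz
        have h10 : 0 ≤ ((m : ℤ) - 2) * (e - 1) := mul_nonneg (by linarith) (by linarith)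
        linarith
      · have hs : (t + 1) / m = t / m := by rw [Nat.succ_div_of_not_dvd hmt]
        rw [hs] at hY'
        have h1 : (m : ℤ) * ((t / m : ℕ) : ℤ) ≤ t := by exact_mod_cast Nat.mul_div_le t m
        push_cast at hY' h1
        have h2 : p ≤ n * t + e * ((t : ℤ) / m) := by linarith
        have h3 : (d : ℤ) * m * p ≤ d * m * (n * t + e * ((t : ℤ) / m)) :=
          mul_le_mul_of_nonneg_left h2 hdm.le
        have h4 : (d : ℤ) * e * (m * ((t : ℤ) / m)) ≤ d * e * t :=
          mul_le_mul_of_nonneg_left h1 (by positivity)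
        rw [hqz] at hkey
        have h5 : 0 ≤ ((d : ℤ) - 1) * (n * m + e) := mul_nonneg (by linarith) (by positivity)
        linarith
  subst ha0
  have hbq : b * (-q) = 1 := by linarith
  have hbu := Int.eq_one_or_neg_one_of_mul_eq_one hbq
  have hb1 : b = 1 := by omega
  subst hb1
  have hq : q = -1 := by omega
  subst hq
  refine ⟨rfl, rfl, ?_⟩
  obtain ⟨j, hj, hY'⟩ := hM _ (hY (by simp; omega))
  simp only at hj hY'
  have hjlt : j < d := by omega
  rw [← Nat.div_div_eq_div_mul, Nat.div_eq_of_lt hjlt] at hY'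
  simp at hY'
  omega

noncomputable section

/-- `P(x,t) = t^d + f_{d-1}(x) t^{d-1} + ⋯ + f_0(x)` in a commutative `k`-algebra. -/
def monicEval {k B : Type*} [CommRing k] [CommRing B] [Algebra k B]
    (d : ℕ) (f : ℕ → Polynomial k) (x t : B) : B :=
  t ^ d + ∑ i ∈ Finset.range d, Polynomial.aeval x (f i) * t ^ i

theorem map_monicEval {k B C : Type*} [CommRing k] [CommRing B] [Algebra k B] [CommRing C]
    [Algebra k C] (h : B →ₐ[k] C) (d : ℕ) (f : ℕ → Polynomial k) (x t : B) :
    h (monicEval d f x t) = monicEval d f (h x) (h t) := by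
  simp [monicEval, Polynomial.aeval_algHom_apply]

section Lead

variable {k : Type*} [Field k] {Γ : Type*} [AddCommGroup Γ] [LinearOrder Γ]

/-- The coefficient of `w` at the exponent `u` is `c` (possibly zero), and the coefficients at all
exponents larger than `u` vanish, where exponents are compared through `ord`. -/
def IsLead (ord : ℤ × ℤ →+ Γ) (w : AddMonoidAlgebra k (ℤ × ℤ)) (u : ℤ × ℤ) (c : k) : Prop :=
  w.coeff u = c ∧ ∀ v, ord u < ord v → w.coeff v = 0

variable {ord : ℤ × ℤ →+ Γ} {w w' : AddMonoidAlgebra k (ℤ × ℤ)} {u u' : ℤ × ℤ} {c c' : k}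

theorem exists_isLead (a b : AddMonoidAlgebra k (ℤ × ℤ)) (hab : ¬(a = 0 ∧ b = 0))
    (ord : ℤ × ℤ →+ Γ) :
    ∃ u α β, IsLead ord a u α ∧ IsLead ord b u β ∧ ¬(α = 0 ∧ β = 0) := by
  classical
  have hne : (a.coeff.support ∪ b.coeff.support).Nonempty := by
    rw [Finset.nonempty_iff_ne_empty]
    intro h
    rw [Finset.union_eq_empty, Finsupp.support_eq_empty, Finsupp.support_eq_empty] at h
    exact hab (by simpa using h)
  obtain ⟨u, hu, hmax⟩ := Finset.exists_max_image _ (fun v => ord v) hne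
  refine ⟨u, _, _, ⟨rfl, fun v hv => ?_⟩, ⟨rfl, fun v hv => ?_⟩, ?_⟩
  · by_contra h
    exact absurd (hmax v (by simp [h])) (not_le.2 hv)
  · by_contra h
    exact absurd (hmax v (by simp [h])) (not_le.2 hv)
  · simp only [Finset.mem_union, Finsupp.mem_support_iff] at hu
    tauto

namespace IsLead

theorem add (h : IsLead ord w u c) (h' : IsLead ord w' u c') :
    IsLead ord (w + w') u (c + c') :=
  ⟨by simp [h.1, h'.1], fun v hv => by simp [h.2 v hv, h'.2 v hv]⟩

theorem sub (h : IsLead ord w u c) (h' : IsLead ord w' u c') :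
    IsLead ord (w - w') u (c - c') :=
  ⟨by simp [h.1, h'.1], fun v hv => by simp [h.2 v hv, h'.2 v hv]⟩

theorem smul (a : k) (h : IsLead ord w u c) : IsLead ord (a • w) u (a * c) :=
  ⟨by simp [h.1], fun v hv => by simp [h.2 v hv]⟩

theorem zero (u : ℤ × ℤ) : IsLead ord (0 : AddMonoidAlgebra k (ℤ × ℤ)) u 0 :=
  ⟨by simp, fun v _ => by simp⟩

theorem sum {ι : Type*} (s : Finset ι) (F : ι → AddMonoidAlgebra k (ℤ × ℤ)) (C : ι → k)
    (h : ∀ i ∈ s, IsLead ord (F i) u (C i)) : IsLead ord (∑ i ∈ s, F i) u (∑ i ∈ s, C i) := by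
  classical
  induction s using Finset.induction_on with
  | empty => simpa using zero u
  | insert a s ha ih =>
    rw [Finset.sum_insert ha, Finset.sum_insert ha]
    exact (h a (by simp)).add (ih fun i hi => h i (by simp [hi]))

theorem of_lt (h : IsLead ord w u c) (huv : ord u < ord u') : IsLead ord w u' 0 :=
  ⟨h.2 _ huv, fun v hv => h.2 v (huv.trans hv)⟩

theorem le_of_ne_zero (h : IsLead ord w u c) (hc : w.coeff u' ≠ 0) : ord u' ≤ ord u := by
  by_contra hlt
  exact hc (h.2 _ (not_le.1 hlt))

theorem single (u : ℤ × ℤ) (c : k) : IsLead ord (AddMonoidAlgebra.single u c) u c :=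
  ⟨by simp, fun v hv => by
    rw [AddMonoidAlgebra.coeff_single, Finsupp.single_apply, if_neg]
    rintro rfl
    exact lt_irrefl _ hv⟩

theorem one : IsLead ord (1 : AddMonoidAlgebra k (ℤ × ℤ)) 0 1 := single 0 1

theorem unique (hinj : Function.Injective ord) (h : IsLead ord w u c) (h' : IsLead ord w u' c')
    (hc : c ≠ 0) (hc' : c' ≠ 0) : u = u' :=
  hinj (le_antisymm (h'.le_of_ne_zero (by rwa [h.1])) (h.le_of_ne_zero (by rwa [h'.1])))

variable [IsOrderedAddMonoid Γ]

theorem mul (hinj : Function.Injective ord) (h : IsLead ord w u c) (h' : IsLead ord w' u' c') :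
    IsLead ord (w * w') (u + u') (c * c') := by
  classical
  constructor
  · rw [AddMonoidAlgebra.coeff_mul_add_of_uniqueAdd, h.1, h'.1]
    intro a b ha hb hab
    have h1 := h.le_of_ne_zero (Finsupp.mem_support_iff.1 ha)
    have h2 := h'.le_of_ne_zero (Finsupp.mem_support_iff.1 hb)
    have h3 : ord a + ord b = ord u + ord u' := by rw [← map_add, hab, map_add]
    have h4 : ord a = ord u := le_antisymm h1 (by
      by_contra hlt
      exact absurd h3 (add_lt_add_of_lt_of_le (not_le.1 hlt) h2).ne)
    have h5 : a = u := hinj h4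
    exact ⟨h5, by rw [h5] at hab; exact add_left_cancel hab⟩
  · intro v hv
    rw [AddMonoidAlgebra.coeff_mul]
    refine Finset.sum_eq_zero fun a ha => Finset.sum_eq_zero fun b hb => if_neg ?_
    rintro rfl
    have h1 := h.le_of_ne_zero (Finsupp.mem_support_iff.1 ha)
    have h2 := h'.le_of_ne_zero (Finsupp.mem_support_iff.1 hb)
    rw [map_add, map_add] at hv
    exact absurd hv (not_lt.2 (add_le_add h1 h2))

theorem pow (hinj : Function.Injective ord) (h : IsLead ord w u c) (N : ℕ) :
    IsLead ord (w ^ N) (N • u) (c ^ N) := by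
  induction N with
  | zero => simpa using one
  | succ N ih => rw [pow_succ, pow_succ, succ_nsmul]; exact ih.mul hinj h

theorem aeval (hinj : Function.Injective ord) (hX : ord (1, 0) < 0) (p : Polynomial k) :
    ∃ c : k, IsLead ord (Polynomial.aeval
      (AddMonoidAlgebra.single ((1, 0) : ℤ × ℤ) (1 : k)) p) 0 c := by
  induction p using Polynomial.induction_on' with
  | add p q hp hq =>
    obtain ⟨a, ha⟩ := hp
    obtain ⟨b, hb⟩ := hq
    exact ⟨a + b, by rw [map_add]; exact ha.add hb⟩
  | monomial N a =>
    have h1 := ((single (ord := ord) (1, 0) (1 : k)).pow hinj N).smul a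
    rw [Polynomial.aeval_monomial, ← Algebra.smul_def]
    rcases Nat.eq_zero_or_pos N with rfl | hN
    · exact ⟨_, by simpa using h1⟩
    · exact ⟨0, h1.of_lt (by rw [map_nsmul, map_zero]; exact nsmul_neg hX hN.ne')⟩

theorem monicEval (hinj : Function.Injective ord) (hX : ord (1, 0) < 0) (d : ℕ)
    (f : ℕ → Polynomial k) (h : IsLead ord w u 1) (hu : 0 < ord u) :
    IsLead ord (monicEval d f (AddMonoidAlgebra.single ((1, 0) : ℤ × ℤ) (1 : k)) w) (d • u) 1 := by
  have h1 := h.pow hinj d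
  have h2 := IsLead.sum (u := d • u) (ord := ord) (Finset.range d)
    (fun i => Polynomial.aeval (AddMonoidAlgebra.single ((1, 0) : ℤ × ℤ) (1 : k)) (f i) * w ^ i)
    (fun _ => 0) (fun i hi => by
      obtain ⟨a, ha⟩ := aeval hinj hX (f i)
      refine (ha.mul hinj (h.pow hinj i)).of_lt ?_
      rw [zero_add, map_nsmul, map_nsmul]
      exact nsmul_lt_nsmul_left hu (Finset.mem_range.1 hi))
  simpa [_root_.monicEval] using h1.add h2

end IsLead

end Lead

section Euler

variable {k : Type*} [Field k]

/-- The linear endomorphism of `k[ℤ²]` multiplying the monomial of exponent `u` by `l u`. -/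
def eulerLinearMap (l : ℤ × ℤ →+ k) :
    AddMonoidAlgebra k (ℤ × ℤ) →ₗ[k] AddMonoidAlgebra k (ℤ × ℤ) where
  toFun w := .ofCoeff (Finsupp.onFinset w.coeff.support (fun u => l u * w.coeff u)
    fun u hu => Finsupp.mem_support_iff.2 (right_ne_zero_of_mul hu))
  map_add' v w := by ext u; simp [mul_add]
  map_smul' a w := by ext u; simp [mul_left_comm]

theorem eulerLinearMap_single (l : ℤ × ℤ →+ k) (u : ℤ × ℤ) (c : k) :
    eulerLinearMap l (AddMonoidAlgebra.single u c) = AddMonoidAlgebra.single u (l u * c) := by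
  ext t
  change l t * (AddMonoidAlgebra.single u c).coeff t = _
  by_cases h : u = t
  · subst h; simp
  · simp [h]

/-- The derivation of `k[ℤ²]` multiplying the monomial of exponent `u` by `l u`. -/
def eulerDerivation (l : ℤ × ℤ →+ k) :
    Derivation k (AddMonoidAlgebra k (ℤ × ℤ)) (AddMonoidAlgebra k (ℤ × ℤ)) :=
  Derivation.mk' (eulerLinearMap l) fun v w => by
    simp only [smul_eq_mul]
    induction v using AddMonoidAlgebra.induction_linear with
    | zero => simp only [zero_mul, map_zero, mul_zero, add_zero]
    | add v₁ v₂ h₁ h₂ => rw [add_mul, map_add, h₁, h₂, map_add]; ring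
    | single u a =>
      induction w using AddMonoidAlgebra.induction_linear with
      | zero => simp only [zero_mul, map_zero, mul_zero, add_zero]
      | add w₁ w₂ h₁ h₂ => rw [mul_add, map_add, h₁, h₂, map_add]; ring
      | single t b =>
        simp only [AddMonoidAlgebra.single_mul_single, eulerLinearMap_single, map_add]
        rw [add_comm t u, ← AddMonoidAlgebra.single_add]
        congr 1
        ring

theorem coeff_eulerDerivation (l : ℤ × ℤ →+ k) (w : AddMonoidAlgebra k (ℤ × ℤ)) (u : ℤ × ℤ) :
    (eulerDerivation l w).coeff u = l u * w.coeff u := rfl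

theorem IsLead.eulerDerivation {Γ : Type*} [AddCommGroup Γ] [LinearOrder Γ] {ord : ℤ × ℤ →+ Γ}
    {w : AddMonoidAlgebra k (ℤ × ℤ)} {u : ℤ × ℤ} {c : k} (l : ℤ × ℤ →+ k) (h : IsLead ord w u c) :
    IsLead ord (eulerDerivation l w) u (l u * c) :=
  ⟨by rw [coeff_eulerDerivation, h.1], fun v hv => by
    rw [coeff_eulerDerivation, h.2 v hv, mul_zero]⟩

theorem eulerDerivation_single (l : ℤ × ℤ →+ k) (u : ℤ × ℤ) (c : k) :
    eulerDerivation l (AddMonoidAlgebra.single u c) = AddMonoidAlgebra.single u (l u * c) :=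
  eulerLinearMap_single l u c

/-- The Euler derivation `x ∂/∂x` of `k[x^±1, s^±1]`. -/
def eulerX : Derivation k (AddMonoidAlgebra k (ℤ × ℤ)) (AddMonoidAlgebra k (ℤ × ℤ)) :=
  eulerDerivation ((Int.castAddHom k).comp (AddMonoidHom.fst ℤ ℤ))

/-- The Euler derivation `s ∂/∂s` of `k[x^±1, s^±1]`. -/
def eulerS : Derivation k (AddMonoidAlgebra k (ℤ × ℤ)) (AddMonoidAlgebra k (ℤ × ℤ)) :=
  eulerDerivation ((Int.castAddHom k).comp (AddMonoidHom.snd ℤ ℤ))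

end Euler

section IteratedLeibniz

variable {k B : Type*} [CommRing k] [CommRing B] [Algebra k B] (D : Derivation k B B)

theorem iterate_derivation_mul (N : ℕ) : ∀ (p q : ℕ) (a b : B), p + q = N →
    D^[p + 1] a = 0 → D^[q + 1] b = 0 →
    D^[N] (a * b) = (N.choose p : B) * (D^[p] a * D^[q] b) := by
  induction N with
  | zero =>
    intro p q a b hpq ha hb
    obtain ⟨rfl, rfl⟩ : p = 0 ∧ q = 0 := by omega
    simp
  | succ N ih =>
    intro p q a b hpq ha hb
    rw [Function.iterate_succ_apply, D.leibniz, smul_eq_mul, smul_eq_mul,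
      iterate_map_add, mul_comm b]
    rcases p with _ | p
    · have ha' : D a = 0 := ha
      obtain rfl : q = N + 1 := by omega
      rw [ha', zero_mul, iterate_map_zero, ih 0 N a (D b) (by omega) ha hb]
      simp
    · rcases q with _ | q
      · have hb' : D b = 0 := hb
        obtain rfl : p = N := by omega
        rw [hb', mul_zero, iterate_map_zero, ih p 0 (D a) b (by omega) ha hb]
        simp
      · rw [ih (p + 1) q a (D b) (by omega) ha hb, ih p (q + 1) (D a) b (by omega) ha hb,
          Nat.choose_succ_succ, ← Function.iterate_succ_apply, ← Function.iterate_succ_apply]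
        push_cast
        ring

variable {D}

theorem IsLND.exists_iterate (hD : IsLND D) {a : B} (ha : a ≠ 0) :
    ∃ p : ℕ, D^[p] a ≠ 0 ∧ D^[p + 1] a = 0 := by
  classical
  have h : ∃ p, D^[p] a = 0 := by
    obtain ⟨p, hp⟩ := hD a
    exact ⟨p, by rwa [Module.End.pow_apply] at hp⟩
  have h0 : Nat.find h ≠ 0 := fun h0 => ha (by simpa [h0] using Nat.find_spec h)
  obtain ⟨p, hp⟩ := Nat.exists_eq_succ_of_ne_zero h0
  exact ⟨p, Nat.find_min h (by omega), by rw [← Nat.succ_eq_add_one, ← hp]; exact Nat.find_spec h⟩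

/-- A locally nilpotent derivation of a domain of characteristic zero kills every element dividing
its own derivative. -/
theorem IsLND.eq_zero_of_dvd [IsDomain B] [CharZero B] (hD : IsLND D)
    {a : B} (h : a ∣ D a) : D a = 0 := by
  by_contra hne
  obtain ⟨w, hw⟩ := h
  have ha : a ≠ 0 := by rintro rfl; simp at hne
  have hw0 : w ≠ 0 := by rintro rfl; simp at hw; exact hne hw
  obtain ⟨p, hp, hp1⟩ := hD.exists_iterate ha
  obtain ⟨q, hq, hq1⟩ := hD.exists_iterate hw0
  have h1 := iterate_derivation_mul D (p + q) p q a w rfl hp1 hq1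
  rw [← hw, ← Function.iterate_succ_apply, show (p + q).succ = q + (p + 1) by omega,
    Function.iterate_add_apply, hp1, iterate_map_zero] at h1
  refine mul_ne_zero ?_ (mul_ne_zero hp hq) h1.symm
  exact_mod_cast (Nat.choose_pos (Nat.le_add_right p q)).ne'

end IteratedLeibniz

end

noncomputable section

/-- A `k`-algebra generated by elements subject to the relations defining `R_{n,e,P,Q}`, together
with a homomorphism to `k[x^±1, s^±1]`. -/
structure IsModel {k B : Type*} [Field k] [CommRing B] [Algebra k B] (n e d m : ℕ)
    (f g : ℕ → Polynomial k) (x s y z : B) (φ : B →ₐ[k] AddMonoidAlgebra k (ℤ × ℤ)) : Prop where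
  two_le_d : 2 ≤ d
  two_le_m : 2 ≤ m
  adjoin_eq_top : Algebra.adjoin k {x, s, y, z} = ⊤
  rel_y : x ^ n * y = monicEval d f x s
  rel_z : x ^ e * z = monicEval m g x y - s
  map_x : φ x = AddMonoidAlgebra.single (1, 0) 1
  map_s : φ s = AddMonoidAlgebra.single (0, 1) 1

/-- The normal form monomials spanning a model over `k`. -/
def normalMonomial {B : Type*} [CommRing B] (d m : ℕ) (x s y z : B) (p : ℕ × ℕ) : B :=
  x ^ p.1 * (s ^ (p.2 % d) * y ^ (p.2 / d % m) * z ^ (p.2 / d / m))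

/-- The exponent of the leading monomial of a normal form monomial. -/
def normalExponent (n e d m : ℕ) (p : ℕ × ℕ) : ℤ × ℤ :=
  ((p.1 : ℤ) - ((n * (p.2 / d) + e * (p.2 / (d * m)) : ℕ) : ℤ), (p.2 : ℤ))

theorem normalExponent_injective (n e d m : ℕ) : Function.Injective (normalExponent n e d m) := by
  rintro ⟨i, j⟩ ⟨i', j'⟩ h
  simp only [normalExponent, Prod.mk.injEq, Nat.cast_inj] at h
  obtain ⟨h1, rfl⟩ := h
  simp only [sub_left_inj, Nat.cast_inj] at h1
  rw [h1]

namespace IsModel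

variable {k B : Type*} [Field k] [CommRing B] [Algebra k B] {n e d m : ℕ}
  {f g : ℕ → Polynomial k} {x s y z : B} {φ : B →ₐ[k] AddMonoidAlgebra k (ℤ × ℤ)}

theorem span_normalMonomial (hB : IsModel n e d m f g x s y z φ) :
    Submodule.span k (Set.range (normalMonomial d m x s y z)) = ⊤ := by
  have hd := hB.two_le_d
  have hm := hB.two_le_m
  set N := Submodule.span k (Set.range (normalMonomial d m x s y z)) with hN
  have hmem : ∀ i a l r, a < d → l < m → x ^ i * (s ^ a * y ^ l * z ^ r) ∈ N := by
    intro i a l r ha hl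
    refine Submodule.subset_span ⟨(i, a + d * (l + m * r)), ?_⟩
    have h1 : (a + d * (l + m * r)) % d = a := by
      rw [Nat.add_mul_mod_self_left, Nat.mod_eq_of_lt ha]
    have h2 : (a + d * (l + m * r)) / d = l + m * r := by
      rw [Nat.add_mul_div_left _ _ (by omega), Nat.div_eq_of_lt ha, zero_add]
    have h3 : (l + m * r) % m = l := by
      rw [Nat.add_mul_mod_self_left, Nat.mod_eq_of_lt hl]
    have h4 : (l + m * r) / m = r := by
      rw [Nat.add_mul_div_left _ _ (by omega), Nat.div_eq_of_lt hl, zero_add]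
    simp only [normalMonomial, h1, h2, h3, h4]
  let T : Subalgebra k B :=
    { carrier := {b | ∀ w ∈ N, b * w ∈ N}
      mul_mem' := fun {a b} ha hb w hw => by rw [mul_assoc]; exact ha _ (hb _ hw)
      add_mem' := fun {a b} ha hb w hw => by rw [add_mul]; exact N.add_mem (ha _ hw) (hb _ hw)
      algebraMap_mem' := fun c w hw => by rw [← Algebra.smul_def]; exact N.smul_mem c hw }
  have hT : ∀ b : B, (∀ i a l r, a < d → l < m → b * (x ^ i * (s ^ a * y ^ l * z ^ r)) ∈ N) →
      b ∈ T := by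
    intro b hb w hw
    induction hw using Submodule.span_induction with
    | mem w hw =>
      obtain ⟨⟨i, j⟩, rfl⟩ := hw
      exact hb _ _ _ _ (Nat.mod_lt _ (by omega)) (Nat.mod_lt _ (by omega))
    | zero => simp
    | add v w _ _ hv hw => rw [mul_add]; exact N.add_mem hv hw
    | smul c w _ hw => rw [mul_smul_comm]; exact N.smul_mem c hw
  have hx : x ∈ T := hT x fun i a l r ha hl => by
    have := hmem (i + 1) a l r ha hl
    rwa [show x * (x ^ i * (s ^ a * y ^ l * z ^ r)) = x ^ (i + 1) * (s ^ a * y ^ l * z ^ r) by ring]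
  have hz : z ∈ T := hT z fun i a l r ha hl => by
    have := hmem i a l (r + 1) ha hl
    rwa [show z * (x ^ i * (s ^ a * y ^ l * z ^ r)) = x ^ i * (s ^ a * y ^ l * z ^ (r + 1)) by ring]
  have hp : ∀ p : Polynomial k, Polynomial.aeval x p ∈ T := fun p =>
    Algebra.adjoin_le (S := T) (Set.singleton_subset_iff.2 hx)
      (Polynomial.aeval_mem_adjoin_singleton k x)
  have hred : ∀ i a r, a < d → s * (s ^ a * z ^ r) ∈ N → x ^ i * (s ^ a * y ^ m * z ^ r) ∈ N := by
    intro i a r ha hs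
    have h1 : y ^ m = x ^ e * z + s -
        ∑ j ∈ Finset.range m, Polynomial.aeval x (g j) * y ^ j := by
      rw [hB.rel_z, monicEval]; ring
    have h2 : s ^ a * y ^ m * z ^ r = x ^ e * (s ^ a * y ^ 0 * z ^ (r + 1)) + s * (s ^ a * z ^ r) -
        ∑ j ∈ Finset.range m, Polynomial.aeval x (g j) * (x ^ 0 * (s ^ a * y ^ j * z ^ r)) := by
      rw [h1, mul_sub, sub_mul, Finset.mul_sum, Finset.sum_mul]
      congr 1
      · ring
      · exact Finset.sum_congr rfl fun j _ => by ring
    refine T.pow_mem hx i _ ?_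
    rw [h2]
    exact N.sub_mem (N.add_mem (hmem _ _ _ _ ha (by omega)) hs)
      (N.sum_mem fun j hj => hp _ _ (hmem _ _ _ _ ha (Finset.mem_range.1 hj)))
  have hs : s ∈ T := hT s fun i a l r ha hl => by
    rw [show s * (x ^ i * (s ^ a * y ^ l * z ^ r)) = x ^ i * (s ^ (a + 1) * y ^ l * z ^ r) by ring]
    rcases Nat.lt_or_ge (a + 1) d with ha' | ha'
    · exact hmem _ _ _ _ ha' hl
    obtain rfl : d = a + 1 := by omega
    have h1 : s ^ (a + 1) = x ^ n * y -
        ∑ i ∈ Finset.range (a + 1), Polynomial.aeval x (f i) * s ^ i := by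
      rw [hB.rel_y, monicEval]; ring
    have h2 : s ^ (a + 1) * y ^ l * z ^ r = x ^ n * (s ^ 0 * y ^ (l + 1) * z ^ r) -
        ∑ i ∈ Finset.range (a + 1),
          Polynomial.aeval x (f i) * (x ^ 0 * (s ^ i * y ^ l * z ^ r)) := by
      rw [h1, sub_mul, sub_mul, Finset.sum_mul, Finset.sum_mul]
      congr 1
      · ring
      · exact Finset.sum_congr rfl fun j _ => by ring
    refine T.pow_mem hx i _ ?_
    rw [h2]
    refine N.sub_mem ?_
      (N.sum_mem fun j hj => hp _ _ (hmem _ _ _ _ (Finset.mem_range.1 hj) hl))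
    rcases Nat.lt_or_ge (l + 1) m with hl' | hl'
    · exact hmem _ _ _ _ (by omega) hl'
    · obtain rfl : m = l + 1 := by omega
      refine hred _ _ _ (by omega) ?_
      have := hmem 0 1 0 r (by omega) (by omega)
      simpa using this
  have hy : y ∈ T := hT y fun i a l r ha hl => by
    rw [show y * (x ^ i * (s ^ a * y ^ l * z ^ r)) = x ^ i * (s ^ a * y ^ (l + 1) * z ^ r) by ring]
    rcases Nat.lt_or_ge (l + 1) m with hl' | hl'
    · exact hmem _ _ _ _ ha hl'
    · obtain rfl : m = l + 1 := by omega
      refine hred _ _ _ ha (hs _ ?_)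
      have := hmem 0 a 0 r ha (by omega)
      simpa using this
  have htop : T = ⊤ := by
    rw [eq_top_iff, ← hB.adjoin_eq_top]
    refine Algebra.adjoin_le ?_
    rintro b (rfl | rfl | rfl | rfl)
    exacts [hx, hs, hy, hz]
  rw [eq_top_iff]
  intro b _
  have hb : b ∈ T := htop ▸ Algebra.mem_top
  have h1 : (1 : B) ∈ N := by simpa using hmem 0 0 0 0 (by omega) (by omega)
  simpa using hb 1 h1

theorem exists_sum_eq (hB : IsModel n e d m f g x s y z φ) (w : B) :
    ∃ c : ℕ × ℕ →₀ k, (c.sum fun p a => a • normalMonomial d m x s y z p) = w := by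
  have : w ∈ Submodule.span k (Set.range (normalMonomial d m x s y z)) := by
    rw [hB.span_normalMonomial]; trivial
  exact Finsupp.mem_span_range_iff_exists_finsupp.1 this

section Lead

variable {Γ : Type*} [AddCommGroup Γ] [LinearOrder Γ] {ord : ℤ × ℤ →+ Γ}

theorem isLead_x (hB : IsModel n e d m f g x s y z φ) : IsLead ord (φ x) (1, 0) 1 := by
  rw [hB.map_x]; exact IsLead.single _ _

theorem isLead_s (hB : IsModel n e d m f g x s y z φ) : IsLead ord (φ s) (0, 1) 1 := by
  rw [hB.map_s]; exact IsLead.single _ _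

theorem eq_single_mul (hB : IsModel n e d m f g x s y z φ) {N : ℕ} {a b : B}
    (h : x ^ N * a = b) : φ a = AddMonoidAlgebra.single (-(N : ℤ), 0) 1 * φ b := by
  rw [← h, map_mul, map_pow, hB.map_x, AddMonoidAlgebra.single_pow, ← mul_assoc,
    AddMonoidAlgebra.single_mul_single]
  simp [← Prod.zero_eq_mk, ← AddMonoidAlgebra.one_def]

variable [IsOrderedAddMonoid Γ]

theorem isLead_y (hB : IsModel n e d m f g x s y z φ) (hinj : Function.Injective ord)
    (hX : ord (1, 0) < 0) (hS : 0 < ord (0, 1)) : IsLead ord (φ y) (-(n : ℤ), (d : ℤ)) 1 := by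
  have h1 := ((hB.isLead_s (ord := ord)).monicEval hinj hX d f hS)
  rw [← hB.map_x, ← map_monicEval] at h1
  have h2 := (IsLead.single (ord := ord) (-(n : ℤ), 0) (1 : k)).mul hinj h1
  rw [← hB.eq_single_mul hB.rel_y] at h2
  simpa using h2

theorem isLead_z (hB : IsModel n e d m f g x s y z φ) (hinj : Function.Injective ord)
    (hX : ord (1, 0) < 0) (hS : 0 < ord (0, 1)) :
    IsLead ord (φ z) (-((n : ℤ) * m + e), (d : ℤ) * m) 1 := by
  have hd := hB.two_le_d
  have hm := hB.two_le_m
  have hY : ord (-(n : ℤ), (d : ℤ)) = d • ord (0, 1) + n • (-ord (1, 0)) := by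
    rw [← map_nsmul, ← map_neg, ← map_nsmul, ← map_add]; simp
  have hYS : ord (0, 1) ≤ ord (-(n : ℤ), (d : ℤ)) := by
    rw [hY]
    calc ord (0, 1) = 1 • ord (0, 1) := (one_nsmul _).symm
      _ ≤ d • ord (0, 1) := nsmul_le_nsmul_left hS.le (by omega)
      _ ≤ _ := le_add_of_nonneg_right (nsmul_nonneg (neg_pos.2 hX).le _)
  have hY0 : 0 < ord (-(n : ℤ), (d : ℤ)) := hS.trans_le hYS
  have h1 := ((hB.isLead_y hinj hX hS).monicEval hinj hX m g hY0)
  rw [← hB.map_x, ← map_monicEval] at h1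
  have h3 : ord (0, 1) < ord (m • ((-(n : ℤ), (d : ℤ)) : ℤ × ℤ)) := by
    rw [map_nsmul]
    refine hYS.trans_lt ?_
    calc ord (-(n : ℤ), (d : ℤ)) = 1 • ord (-(n : ℤ), (d : ℤ)) := (one_nsmul _).symm
      _ < m • ord (-(n : ℤ), (d : ℤ)) := nsmul_lt_nsmul_left hY0 (by omega)
  have h4 := h1.sub ((hB.isLead_s (ord := ord)).of_lt h3)
  rw [← map_sub] at h4
  have h2 := (IsLead.single (ord := ord) (-(e : ℤ), 0) (1 : k)).mul hinj h4
  rw [← hB.eq_single_mul hB.rel_z] at h2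
  convert h2 using 1
  · ext <;> simp <;> ring
  · simp

theorem isLead_normalMonomial (hB : IsModel n e d m f g x s y z φ) (hinj : Function.Injective ord)
    (hX : ord (1, 0) < 0) (hS : 0 < ord (0, 1)) (p : ℕ × ℕ) :
    IsLead ord (φ (normalMonomial d m x s y z p)) (normalExponent n e d m p) 1 := by
  obtain ⟨i, j⟩ := p
  have h := (hB.isLead_x.pow hinj i).mul hinj (((hB.isLead_s.pow hinj (j % d)).mul hinj
    ((hB.isLead_y hinj hX hS).pow hinj (j / d % m))).mul hinj
    ((hB.isLead_z hinj hX hS).pow hinj (j / d / m)))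
  simp only [normalMonomial, map_mul, map_pow]
  convert h using 1
  · have h1 : (d : ℤ) * ((j / d : ℕ) : ℤ) + ((j % d : ℕ) : ℤ) = j := by
      exact_mod_cast Nat.div_add_mod j d
    have h2 : (m : ℤ) * ((j / d / m : ℕ) : ℤ) + ((j / d % m : ℕ) : ℤ) = ((j / d : ℕ) : ℤ) := by
      exact_mod_cast Nat.div_add_mod (j / d) m
    rw [normalExponent, ← Nat.div_div_eq_div_mul]
    generalize j / d / m = r at *
    generalize j / d % m = l at *
    generalize j / d = t at *
    generalize j % d = a at *
    ext
    · simp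
      linear_combination (n : ℤ) * h2
    · simp
      linear_combination -h1 - (d : ℤ) * h2
  · simp

theorem exists_isLead_sum (hB : IsModel n e d m f g x s y z φ) (hinj : Function.Injective ord)
    (hX : ord (1, 0) < 0) (hS : 0 < ord (0, 1)) {c : ℕ × ℕ →₀ k} (hc : c ≠ 0) :
    ∃ p, c p ≠ 0 ∧ IsLead ord (φ (c.sum fun p a => a • normalMonomial d m x s y z p))
      (normalExponent n e d m p) (c p) ∧
      ∀ q ∈ c.support, ord (normalExponent n e d m q) ≤ ord (normalExponent n e d m p) := by
  classical
  obtain ⟨p, hp, hmax⟩ := Finset.exists_max_image _ (fun q => ord (normalExponent n e d m q))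
    (Finsupp.support_nonempty_iff.2 hc)
  refine ⟨p, Finsupp.mem_support_iff.1 hp, ?_, hmax⟩
  have h := IsLead.sum (ord := ord) (u := normalExponent n e d m p) c.support
    (fun q => c q • φ (normalMonomial d m x s y z q)) (fun q => if q = p then c p else 0)
    (fun q hq => by
      have h1 := (hB.isLead_normalMonomial hinj hX hS q).smul (c q)
      rw [mul_one] at h1
      split_ifs with hqp
      · rwa [hqp] at h1 ⊢
      · exact h1.of_lt (lt_of_le_of_ne (hmax q hq)
          fun heq => hqp (normalExponent_injective n e d m (hinj heq))))
  rw [Finset.sum_ite_eq' c.support p, if_pos hp] at h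
  simpa [Finsupp.sum, map_sum] using h

theorem le_of_isLead_sum (hB : IsModel n e d m f g x s y z φ) (hinj : Function.Injective ord)
    (hX : ord (1, 0) < 0) (hS : 0 < ord (0, 1)) {c : ℕ × ℕ →₀ k} {u : ℤ × ℤ} {γ : k}
    (h : IsLead ord (φ (c.sum fun p a => a • normalMonomial d m x s y z p)) u γ)
    (q : ℕ × ℕ) (hq : q ∈ c.support) : ord (normalExponent n e d m q) ≤ ord u := by
  have hc : c ≠ 0 := by rintro rfl; simp at hq
  obtain ⟨p, hp, hlead, hle⟩ := hB.exists_isLead_sum hinj hX hS hc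
  exact (hle q hq).trans (h.le_of_ne_zero (by rwa [hlead.1]))

theorem exists_normalExponent_eq (hB : IsModel n e d m f g x s y z φ)
    (hinj : Function.Injective ord) (hX : ord (1, 0) < 0) (hS : 0 < ord (0, 1)) {w : B}
    {u : ℤ × ℤ} {γ : k} (h : IsLead ord (φ w) u γ) (hγ : γ ≠ 0) :
    ∃ p, u = normalExponent n e d m p := by
  obtain ⟨c, rfl⟩ := hB.exists_sum_eq w
  have hc : c ≠ 0 := by rintro rfl; exact hγ (by simpa using h.1.symm)
  obtain ⟨p, hp, hlead, -⟩ := hB.exists_isLead_sum hinj hX hS hc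
  exact ⟨p, h.unique hinj hlead hγ hp⟩

end Lead

/-- The order on exponents comparing the pole order in `x` first. -/
def ordX : ℤ × ℤ →+ ℤ ×ₗ ℤ where
  toFun u := toLex (-u.1, u.2)
  map_zero' := rfl
  map_add' u v := by rw [← toLex_add]; simp [add_comm]

/-- The order on exponents comparing the degree in `s` first. -/
def ordS : ℤ × ℤ →+ ℤ ×ₗ ℤ where
  toFun u := toLex (u.2, -u.1)
  map_zero' := rfl
  map_add' u v := by rw [← toLex_add]; simp [add_comm]

theorem ordX_injective : Function.Injective ordX := by
  rintro ⟨i, j⟩ ⟨i', j'⟩ h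
  have := toLex.injective h
  simpa using this

theorem ordS_injective : Function.Injective ordS := by
  rintro ⟨i, j⟩ ⟨i', j'⟩ h
  have := toLex.injective h
  simp at this
  simp [this]

theorem ordX_x : ordX (1, 0) < 0 := by
  change toLex ((-1 : ℤ), (0 : ℤ)) < toLex (0, 0)
  simp [Prod.Lex.toLex_lt_toLex]

theorem ordX_s : 0 < ordX (0, 1) := by
  change toLex ((0 : ℤ), (0 : ℤ)) < toLex (-0, 1)
  simp [Prod.Lex.toLex_lt_toLex]

theorem ordS_x : ordS (1, 0) < 0 := by
  change toLex ((0 : ℤ), (-1 : ℤ)) < toLex (0, 0)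
  simp [Prod.Lex.toLex_lt_toLex]

theorem ordS_s : 0 < ordS (0, 1) := by
  change toLex ((0 : ℤ), (0 : ℤ)) < toLex (1, -0)
  simp [Prod.Lex.toLex_lt_toLex]

theorem fst_le_of_ordX_le {u v : ℤ × ℤ} (h : ordX u ≤ ordX v) : v.1 ≤ u.1 := by
  change toLex (-u.1, u.2) ≤ toLex (-v.1, v.2) at h
  rw [Prod.Lex.toLex_le_toLex] at h
  rcases h with h | h
  · simp only at h; omega
  · simp only at h; omega

theorem snd_le_of_ordS_le {u v : ℤ × ℤ} (h : ordS u ≤ ordS v) : u.2 ≤ v.2 := by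
  change toLex (u.2, -u.1) ≤ toLex (v.2, -v.1) at h
  rw [Prod.Lex.toLex_le_toLex] at h
  rcases h with h | h
  · exact h.le
  · exact h.1.le

theorem injective (hB : IsModel n e d m f g x s y z φ) : Function.Injective φ := by
  rw [injective_iff_map_eq_zero]
  intro w hw
  by_contra hne
  obtain ⟨c, rfl⟩ := hB.exists_sum_eq w
  have hc : c ≠ 0 := by rintro rfl; simp at hne
  obtain ⟨p, hp, hlead, -⟩ := hB.exists_isLead_sum ordX_injective ordX_x ordX_s hc
  rw [hw] at hlead
  exact hp (by simpa using hlead.1.symm)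

end IsModel

end

noncomputable section

namespace IsModel

variable {k B : Type*} [Field k] [CommRing B] [Algebra k B] {n e d m : ℕ}
  {f g : ℕ → Polynomial k} {x s y z : B} {φ : B →ₐ[k] AddMonoidAlgebra k (ℤ × ℤ)}

/-- The derivation of `k[x^±1, s^±1]` extending a derivation of a model. -/
def extend (φ : B →ₐ[k] AddMonoidAlgebra k (ℤ × ℤ)) (x s : B) (D : Derivation k B B) :
    Derivation k (AddMonoidAlgebra k (ℤ × ℤ)) (AddMonoidAlgebra k (ℤ × ℤ)) :=
  (AddMonoidAlgebra.single (-1, 0) 1 * φ (D x)) • eulerX +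
    (AddMonoidAlgebra.single (0, -1) 1 * φ (D s)) • eulerS

theorem extend_apply (x s : B) (D : Derivation k B B) (w : AddMonoidAlgebra k (ℤ × ℤ)) :
    extend φ x s D w = AddMonoidAlgebra.single (-1, 0) 1 * φ (D x) * eulerX w +
      AddMonoidAlgebra.single (0, -1) 1 * φ (D s) * eulerS w := rfl

theorem map_derivation (hB : IsModel n e d m f g x s y z φ) (D : Derivation k B B) (w : B) :
    φ (D w) = extend φ x s D (φ w) := by
  let T : Subalgebra k B :=
    { carrier := {w | φ (D w) = extend φ x s D (φ w)}
      mul_mem' := fun {a b} ha hb => by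
        simp only [Set.mem_ofPred_eq] at ha hb ⊢
        simp only [map_mul, Derivation.leibniz, map_add, smul_eq_mul, ha, hb]
      add_mem' := fun {a b} ha hb => by
        simp only [Set.mem_ofPred_eq] at ha hb ⊢
        simp only [map_add, ha, hb]
      algebraMap_mem' := fun c => by
        simp only [Set.mem_ofPred_eq, Derivation.map_algebraMap, map_zero, AlgHom.commutes] }
  have hcancel : ∀ {u v : B}, u ∈ T → u * v ∈ T → φ u ≠ 0 → v ∈ T := by
    intro u v hu huv hne
    have hu' : φ (D u) = extend φ x s D (φ u) := hu
    have huv' : φ (D (u * v)) = extend φ x s D (φ (u * v)) := huv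
    simp only [map_mul, Derivation.leibniz, map_add, smul_eq_mul, hu'] at huv'
    exact mul_left_cancel₀ hne (add_right_cancel huv')
  have hx : x ∈ T := by
    change φ (D x) = extend φ x s D (φ x)
    rw [extend_apply, hB.map_x, eulerX, eulerS, eulerDerivation_single, eulerDerivation_single,
      mul_right_comm, AddMonoidAlgebra.single_mul_single]
    simp [← Prod.zero_eq_mk, ← AddMonoidAlgebra.one_def]
  have hs : s ∈ T := by
    change φ (D s) = extend φ x s D (φ s)
    rw [extend_apply, hB.map_s, eulerX, eulerS, eulerDerivation_single, eulerDerivation_single,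
      mul_right_comm (AddMonoidAlgebra.single (0, -1) 1), AddMonoidAlgebra.single_mul_single]
    simp [← Prod.zero_eq_mk, ← AddMonoidAlgebra.one_def]
  have hp : ∀ p : Polynomial k, Polynomial.aeval x p ∈ T := fun p =>
    Algebra.adjoin_le (S := T) (Set.singleton_subset_iff.2 hx)
      (Polynomial.aeval_mem_adjoin_singleton k x)
  have hmonic : ∀ {t : B} (N : ℕ) (F : ℕ → Polynomial k), t ∈ T → monicEval N F x t ∈ T :=
    fun N F ht => T.add_mem (T.pow_mem ht N)
      (T.sum_mem fun i _ => T.mul_mem (hp _) (T.pow_mem ht i))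
  have hx0 : ∀ N, φ (x ^ N) ≠ 0 := fun N => by
    rw [map_pow, hB.map_x]
    exact pow_ne_zero _ (by simp)
  have hy : y ∈ T := hcancel (T.pow_mem hx n) (by rw [hB.rel_y]; exact hmonic _ _ hs) (hx0 n)
  have hz : z ∈ T := hcancel (T.pow_mem hx e)
    (by rw [hB.rel_z]; exact T.sub_mem (hmonic _ _ hy) hs) (hx0 e)
  have htop : T = ⊤ := by
    rw [eq_top_iff, ← hB.adjoin_eq_top]
    refine Algebra.adjoin_le ?_
    rintro b (rfl | rfl | rfl | rfl)
    exacts [hx, hs, hy, hz]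
  have : w ∈ T := htop ▸ Algebra.mem_top
  exact this

theorem isDomain (hB : IsModel n e d m f g x s y z φ) : IsDomain B :=
  hB.injective.isDomain φ.toRingHom

theorem charZero [CharZero k] (hB : IsModel n e d m f g x s y z φ) : CharZero B :=
  have := hB.isDomain
  charZero_of_injective_algebraMap (algebraMap k B).injective

section Lead

variable {Γ : Type*} [AddCommGroup Γ] [LinearOrder Γ] [IsOrderedAddMonoid Γ] {ord : ℤ × ℤ →+ Γ}
  {D : Derivation k B B} {χ u : ℤ × ℤ} {α β γ : k}

theorem isLead_derivation (hB : IsModel n e d m f g x s y z φ) (hinj : Function.Injective ord)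
    (ha : IsLead ord (AddMonoidAlgebra.single (-1, 0) 1 * φ (D x)) χ α)
    (hb : IsLead ord (AddMonoidAlgebra.single (0, -1) 1 * φ (D s)) χ β) {w : B}
    (hw : IsLead ord (φ w) u γ) : IsLead ord (φ (D w)) (u + χ) ((α * u.1 + β * u.2) * γ) := by
  rw [hB.map_derivation, extend_apply]
  have h := (ha.mul hinj (hw.eulerDerivation ((Int.castAddHom k).comp (AddMonoidHom.fst ℤ ℤ)))).add
    (hb.mul hinj (hw.eulerDerivation ((Int.castAddHom k).comp (AddMonoidHom.snd ℤ ℤ))))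
  rw [add_comm u χ, show ((α * u.1 + β * u.2) * γ : k) = α * (u.1 * γ) + β * (u.2 * γ) by ring]
  exact h

theorem isLead_iterate (hB : IsModel n e d m f g x s y z φ) (hinj : Function.Injective ord)
    (ha : IsLead ord (AddMonoidAlgebra.single (-1, 0) 1 * φ (D x)) χ α)
    (hb : IsLead ord (AddMonoidAlgebra.single (0, -1) 1 * φ (D s)) χ β) {w : B}
    (hw : IsLead ord (φ w) u γ) (N : ℕ) : IsLead ord (φ (D^[N] w)) (u + N • χ)
      ((∏ t ∈ Finset.range N,
        (α * ((u.1 + t * χ.1 : ℤ) : k) + β * ((u.2 + t * χ.2 : ℤ) : k))) * γ) := by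
  induction N with
  | zero => simpa using hw
  | succ N ih =>
    rw [Function.iterate_succ_apply']
    convert hB.isLead_derivation hinj ha hb ih using 1
    · rw [succ_nsmul, add_assoc]
    · rw [Finset.prod_range_succ]
      simp
      ring

theorem exists_natCast_mul (hB : IsModel n e d m f g x s y z φ) (hinj : Function.Injective ord)
    (ha : IsLead ord (AddMonoidAlgebra.single (-1, 0) 1 * φ (D x)) χ α)
    (hb : IsLead ord (AddMonoidAlgebra.single (0, -1) 1 * φ (D s)) χ β) (hD : IsLND D) {w : B}
    (hw : IsLead ord (φ w) u γ) (hγ : γ ≠ 0) :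
    ∃ t : ℕ, α * u.1 + β * u.2 = t * -(α * χ.1 + β * χ.2) := by
  obtain ⟨N, hN⟩ := hD w
  rw [Module.End.pow_apply] at hN
  have h := (hB.isLead_iterate hinj ha hb hw N).1
  have hN' : D^[N] w = 0 := hN
  rw [hN', map_zero, AddMonoidAlgebra.coeff_zero, Finsupp.zero_apply, eq_comm, mul_eq_zero,
    or_iff_left hγ, Finset.prod_eq_zero_iff] at h
  obtain ⟨t, -, ht⟩ := h
  refine ⟨t, ?_⟩
  push_cast at ht
  linear_combination ht

end Lead

variable {D : Derivation k B B}

theorem eq_zero_of_map_eq_zero (hB : IsModel n e d m f g x s y z φ)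
    (hx : D x = 0) (hs : D s = 0) : D = 0 := by
  ext w
  refine hB.injective ?_
  rw [hB.map_derivation, extend_apply, hx, hs]
  simp

theorem exists_isLead_derivation [CharZero k] (hB : IsModel n e d m f g x s y z φ)
    (hn : 1 ≤ n) (hne : ¬(n = 1 ∧ e = 0)) (hD : IsLND D) (hD0 : D ≠ 0) :
    ∃ (χ : ℤ × ℤ) (β : k),
      IsLead ordX (AddMonoidAlgebra.single (-1, 0) 1 * φ (D x)) χ 0 ∧
      IsLead ordX (AddMonoidAlgebra.single (0, -1) 1 * φ (D s)) χ β ∧ (n : ℤ) ≤ χ.1 := by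
  have hab : ¬(AddMonoidAlgebra.single ((-1, 0) : ℤ × ℤ) (1 : k) * φ (D x) = 0 ∧
      AddMonoidAlgebra.single ((0, -1) : ℤ × ℤ) (1 : k) * φ (D s) = 0) := by
    rintro ⟨h1, h2⟩
    rw [mul_eq_zero, or_iff_right (by simp), map_eq_zero_iff _ hB.injective] at h1 h2
    exact hD0 (hB.eq_zero_of_map_eq_zero h1 h2)
  obtain ⟨χ, α, β, ha, hb, hαβ⟩ := exists_isLead _ _ hab ordX
  have hX := hB.isLead_x (ord := ordX)
  have hS := hB.isLead_s (ord := ordX)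
  have hY := hB.isLead_y ordX_injective ordX_x ordX_s
  have hZ := hB.isLead_z ordX_injective ordX_x ordX_s
  obtain ⟨a, ha'⟩ := hB.exists_natCast_mul ordX_injective ha hb hD hX one_ne_zero
  obtain ⟨b, hb'⟩ := hB.exists_natCast_mul ordX_injective ha hb hD hS one_ne_zero
  obtain ⟨c, hc'⟩ := hB.exists_natCast_mul ordX_injective ha hb hD hY one_ne_zero
  obtain ⟨r, hr'⟩ := hB.exists_natCast_mul ordX_injective ha hb hD hZ one_ne_zero
  generalize hρ : -(α * (χ.1 : k) + β * (χ.2 : k)) = ρ at ha' hb' hc' hr'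
  push_cast at ha' hb' hc' hr'
  have hα : α = a * ρ := by linear_combination ha'
  have hβ : β = b * ρ := by linear_combination hb'
  have hρ0 : ρ ≠ 0 := by
    rintro rfl
    exact hαβ ⟨by rw [hα, mul_zero], by rw [hβ, mul_zero]⟩
  have h1 : (b : ℤ) * χ.2 + 1 = a * -χ.1 := by
    have : ((b : k) * χ.2 + 1) = a * -χ.1 := mul_right_cancel₀ hρ0 (by
      linear_combination (-(χ.1 : k)) * hα - (χ.2 : k) * hβ - hρ)
    exact_mod_cast this
  have h2 : (d : ℤ) * b - n * a = c := by
    have : (d : k) * b - n * a = c := mul_right_cancel₀ hρ0 (by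
      linear_combination hc' - (d : k) * hβ + (n : k) * hα)
    exact_mod_cast this
  have h3 : (d : ℤ) * m * b - (n * m + e) * a = r := by
    have : (d : k) * m * b - (n * m + e) * a = r := mul_right_cancel₀ hρ0 (by
      linear_combination hr' - (d * m : k) * hβ + (n * m + e : k) * hα)
    exact_mod_cast this
  have hmem : ∀ {w : B} {u : ℤ × ℤ}, IsLead ordX (φ w) u 1 → α * u.1 + β * u.2 ≠ 0 →
      ∃ p, u + χ = normalExponent n e d m p := fun hw hu =>
    hB.exists_normalExponent_eq ordX_injective ordX_x ordX_s
      (hB.isLead_derivation ordX_injective ha hb hw) (by rwa [mul_one])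
  have key := homogeneous_degree_restriction hn hne hB.two_le_d hB.two_le_m
    (M := fun u => ∃ p, u = normalExponent n e d m p) (a := a) (b := b) (p := -χ.1) (q := χ.2)
    (by
      rintro _ ⟨p, rfl⟩
      exact ⟨p.2, rfl, by dsimp only [normalExponent]; linarith [Int.natCast_nonneg p.1]⟩)
    (by positivity) (by positivity) h1 (by rw [h2]; positivity) (by rw [h3]; positivity)
    (fun h => by
      obtain ⟨p, hp⟩ := hmem hX (by
        push_cast; rw [ha']; exact mul_ne_zero (by exact_mod_cast h) hρ0)
      exact ⟨p, by rw [← hp]; ext <;> simp⟩)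
    (fun h => by
      obtain ⟨p, hp⟩ := hmem hS (by
        push_cast; rw [hb']; exact mul_ne_zero (by exact_mod_cast h) hρ0)
      exact ⟨p, by rw [← hp]; ext <;> simp [add_comm]⟩)
    (fun h => by
      rw [h2] at h
      obtain ⟨p, hp⟩ := hmem hY (by
        push_cast; rw [hc']; exact mul_ne_zero (by exact_mod_cast h) hρ0)
      exact ⟨p, by rw [← hp]; ext <;> simp <;> ring⟩)
    (fun h => by
      rw [h3] at h
      obtain ⟨p, hp⟩ := hmem hZ (by
        push_cast; rw [hr']; exact mul_ne_zero (by exact_mod_cast h) hρ0)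
      exact ⟨p, by rw [← hp]; ext <;> simp <;> ring⟩)
  obtain ⟨ha0, -, hχ⟩ := key
  have hα0 : α = 0 := by rw [hα, show (a : k) = 0 by exact_mod_cast ha0, zero_mul]
  exact ⟨χ, β, hα0 ▸ ha, hb, by omega⟩

end IsModel

end

noncomputable section

theorem derivation_mem_adjoin {k B : Type*} [CommRing k] [CommRing B] [Algebra k B]
    {D : Derivation k B B} {S : Set B} {T : Subalgebra k B} (hST : S ⊆ T)
    (h : ∀ a ∈ S, D a ∈ T) {w : B} (hw : w ∈ Algebra.adjoin k S) : D w ∈ T := by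
  induction hw using Algebra.adjoin_induction with
  | mem a ha => exact h a ha
  | algebraMap c => simp
  | add a b _ _ ha hb => rw [map_add]; exact T.add_mem ha hb
  | mul a b ha' hb' ha hb =>
    rw [Derivation.leibniz, smul_eq_mul, smul_eq_mul]
    exact T.add_mem (T.mul_mem (Algebra.adjoin_le hST ha') hb)
      (T.mul_mem (Algebra.adjoin_le hST hb') ha)

theorem exists_derivation_eq_mul {k B : Type*} [CommRing k] [CommRing B] [Algebra k B]
    {D : Derivation k B B} {x s : B} (hx : D x = 0) {w : B} (hw : w ∈ Algebra.adjoin k {x, s}) :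
    ∃ v ∈ Algebra.adjoin k {x, s}, D w = v * D s := by
  induction hw using Algebra.adjoin_induction with
  | mem a ha =>
    rcases ha with rfl | rfl
    · exact ⟨0, zero_mem _, by simp [hx]⟩
    · exact ⟨1, one_mem _, by simp⟩
  | algebraMap c => exact ⟨0, zero_mem _, by simp⟩
  | add a b _ _ ha hb =>
    obtain ⟨v, hv, ha⟩ := ha
    obtain ⟨v', hv', hb⟩ := hb
    exact ⟨v + v', add_mem hv hv', by rw [map_add, ha, hb, add_mul]⟩
  | mul a b ha' hb' ha hb =>
    obtain ⟨v, hv, ha⟩ := ha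
    obtain ⟨v', hv', hb⟩ := hb
    refine ⟨a * v' + b * v, add_mem (mul_mem ha' hv') (mul_mem hb' hv), ?_⟩
    rw [Derivation.leibniz, ha, hb, smul_eq_mul, smul_eq_mul]
    ring

theorem aeval_mem_adjoin_of_mem {k B : Type*} [CommRing k] [CommRing B] [Algebra k B] {x : B}
    {S : Set B} (hx : x ∈ S) (p : Polynomial k) : Polynomial.aeval x p ∈ Algebra.adjoin k S :=
  Algebra.adjoin_mono (Set.singleton_subset_iff.2 hx)
    (Polynomial.aeval_mem_adjoin_singleton k x)

theorem monicEval_mem_adjoin {k B : Type*} [CommRing k] [CommRing B] [Algebra k B] {x t : B}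
    {S : Set B} (hx : x ∈ S) (ht : t ∈ Algebra.adjoin k S) (N : ℕ) (F : ℕ → Polynomial k) :
    monicEval N F x t ∈ Algebra.adjoin k S :=
  add_mem (pow_mem ht _) (sum_mem fun _ _ => mul_mem (aeval_mem_adjoin_of_mem hx _) (pow_mem ht _))

namespace IsModel

variable {k B : Type*} [Field k] [CharZero k] [CommRing B] [Algebra k B] {n e d m : ℕ}
  {f g : ℕ → Polynomial k} {x s y z : B} {φ : B →ₐ[k] AddMonoidAlgebra k (ℤ × ℤ)}
  {D : Derivation k B B}

theorem derivation_x_eq_zero (hB : IsModel n e d m f g x s y z φ)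
    (hn : 1 ≤ n) (hne : ¬(n = 1 ∧ e = 0)) (hD : IsLND D) (hD0 : D ≠ 0) : D x = 0 := by
  have := hB.isDomain
  have := hB.charZero
  obtain ⟨χ, β, ha, hb, hχ⟩ := hB.exists_isLead_derivation hn hne hD hD0
  have hlead := hB.isLead_derivation ordX_injective ha hb hB.isLead_x
  refine hD.eq_zero_of_dvd ?_
  obtain ⟨c, hc⟩ := hB.exists_sum_eq (D x)
  rw [← hc] at hlead
  rw [← hc]
  refine Finset.dvd_sum fun q hq => ?_
  have h := fst_le_of_ordX_le
    (hB.le_of_isLead_sum ordX_injective ordX_x ordX_s hlead q hq)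
  simp only [normalExponent, Prod.fst_add] at h
  have hq1 : q.1 ≠ 0 := by omega
  dsimp only
  rw [Algebra.smul_def]
  exact ((dvd_pow_self x hq1).mul_right _).mul_left _

theorem exists_derivation_s_eq (hB : IsModel n e d m f g x s y z φ)
    (hn : 1 ≤ n) (hne : ¬(n = 1 ∧ e = 0)) (hD : IsLND D) (hD0 : D ≠ 0) :
    ∃ p : Polynomial k, D s = x ^ n * Polynomial.aeval x p := by
  have hx := hB.derivation_x_eq_zero hn hne hD hD0
  obtain ⟨χ, β, ha, hb, hχ⟩ := hB.exists_isLead_derivation hn hne hD hD0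
  have hlead := hB.isLead_derivation ordX_injective ha hb hB.isLead_s
  obtain ⟨χ', α', β', ha', hb', hαβ⟩ := exists_isLead
    (AddMonoidAlgebra.single ((-1, 0) : ℤ × ℤ) (1 : k) * φ (D x))
    (AddMonoidAlgebra.single ((0, -1) : ℤ × ℤ) (1 : k) * φ (D s)) (by
      rintro ⟨-, h2⟩
      rw [mul_eq_zero, or_iff_right (by simp), map_eq_zero_iff _ hB.injective] at h2
      exact hD0 (hB.eq_zero_of_map_eq_zero hx h2)) ordS
  have hα' : α' = 0 := by
    rw [← ha'.1, hx]
    simp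
  have hβ' : β' ≠ 0 := fun h => hαβ ⟨hα', h⟩
  have hlead' := hB.isLead_derivation ordS_injective ha' hb' hB.isLead_s
  have hχ' : χ'.2 < 0 := by
    obtain ⟨t, ht⟩ := hB.exists_natCast_mul ordS_injective ha' hb' hD hB.isLead_s one_ne_zero
    have h1 : (t : ℤ) * -χ'.2 = 1 := by
      have : (t : k) * -χ'.2 = 1 := mul_right_cancel₀ hβ' (by
        push_cast at ht
        rw [hα'] at ht
        linear_combination -ht)
      exact_mod_cast this
    by_contra hlt
    nlinarith [mul_nonneg (Int.natCast_nonneg t) (not_lt.1 hlt)]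
  obtain ⟨c, hc⟩ := hB.exists_sum_eq (D s)
  rw [← hc] at hlead hlead'
  refine ⟨∑ q ∈ c.support, Polynomial.monomial (q.1 - n) (c q), ?_⟩
  rw [← hc, map_sum, Finset.mul_sum]
  refine Finset.sum_congr rfl fun q hq => ?_
  have h1 := fst_le_of_ordX_le
    (hB.le_of_isLead_sum ordX_injective ordX_x ordX_s hlead q hq)
  have h2 := snd_le_of_ordS_le
    (hB.le_of_isLead_sum ordS_injective ordS_x ordS_s hlead' q hq)
  simp only [normalExponent, Prod.fst_add, Prod.snd_add] at h1 h2
  have hq2 : q.2 = 0 := by omega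
  have hq1 : n + (q.1 - n) = q.1 := by omega
  simp only [Polynomial.aeval_monomial, ← Algebra.smul_def, mul_smul_comm, ← pow_add, hq1,
    normalMonomial, hq2]
  simp

theorem derivation_y_mem (hB : IsModel n e d m f g x s y z φ)
    (hn : 1 ≤ n) (hne : ¬(n = 1 ∧ e = 0)) (hD : IsLND D) (hD0 : D ≠ 0) :
    D y ∈ Algebra.adjoin k {x, s} := by
  have := hB.isDomain
  have hx := hB.derivation_x_eq_zero hn hne hD hD0
  obtain ⟨p, hp⟩ := hB.exists_derivation_s_eq hn hne hD hD0
  obtain ⟨v, hv, hv'⟩ := exists_derivation_eq_mul (k := k) hx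
    (monicEval_mem_adjoin (x := x) (t := s) (S := {x, s}) (by simp)
      (Algebra.subset_adjoin (by simp)) d f)
  have hx0 : x ^ n ≠ 0 := by
    refine pow_ne_zero _ fun h => ?_
    have := hB.map_x
    rw [h, map_zero] at this
    exact AddMonoidAlgebra.single_ne_zero.2 one_ne_zero this.symm
  have h : D y = v * Polynomial.aeval x p := mul_left_cancel₀ hx0 (by
    rw [← hB.rel_y, Derivation.leibniz, Derivation.leibniz_pow, hx, hp, smul_zero, smul_zero,
      smul_zero, add_zero, smul_eq_mul] at hv'
    linear_combination hv')
  rw [h]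
  exact mul_mem hv (aeval_mem_adjoin_of_mem (by simp) p)

theorem derivation_s_ne_zero (hB : IsModel n e d m f g x s y z φ)
    (hn : 1 ≤ n) (hne : ¬(n = 1 ∧ e = 0)) (hD : IsLND D) (hD0 : D ≠ 0) : D s ≠ 0 := fun h =>
  hD0 (hB.eq_zero_of_map_eq_zero (hB.derivation_x_eq_zero hn hne hD hD0) h)

theorem derivation_s_mem (hB : IsModel n e d m f g x s y z φ)
    (hn : 1 ≤ n) (hne : ¬(n = 1 ∧ e = 0)) (hD : IsLND D) (hD0 : D ≠ 0) :
    D s ∈ Algebra.adjoin k {x, s} := by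
  obtain ⟨p, hp⟩ := hB.exists_derivation_s_eq hn hne hD hD0
  rw [hp]
  exact mul_mem (pow_mem (Algebra.subset_adjoin (by simp)) _)
    (aeval_mem_adjoin_of_mem (by simp) p)

theorem derivation_mem_adjoin_pair (hB : IsModel n e d m f g x s y z φ)
    (hn : 1 ≤ n) (hne : ¬(n = 1 ∧ e = 0)) (hD : IsLND D) (hD0 : D ≠ 0) {w : B}
    (hw : w ∈ Algebra.adjoin k {x, s}) : D w ∈ Algebra.adjoin k {x, s} := by
  refine derivation_mem_adjoin Algebra.subset_adjoin ?_ hw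
  rintro a (rfl | rfl)
  · rw [hB.derivation_x_eq_zero hn hne hD hD0]
    exact zero_mem _
  · exact hB.derivation_s_mem hn hne hD hD0

theorem derivation_mem_adjoin_triple (hB : IsModel n e d m f g x s y z φ)
    (hn : 1 ≤ n) (hne : ¬(n = 1 ∧ e = 0)) (hD : IsLND D) (hD0 : D ≠ 0) {w : B}
    (hw : w ∈ Algebra.adjoin k {x, s, y}) : D w ∈ Algebra.adjoin k {x, s, y} := by
  have hle : Algebra.adjoin k {x, s} ≤ Algebra.adjoin k {x, s, y} :=
    Algebra.adjoin_mono (by simp [Set.insert_subset_iff])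
  refine derivation_mem_adjoin Algebra.subset_adjoin ?_ hw
  rintro a (rfl | rfl | rfl)
  · rw [hB.derivation_x_eq_zero hn hne hD hD0]
    exact zero_mem _
  · exact hle (hB.derivation_s_mem hn hne hD hD0)
  · exact hle (hB.derivation_y_mem hn hne hD hD0)

end IsModel

end

noncomputable section

section Laurent

variable (k : Type*) [Field k] (n e d m : ℕ) (f g : ℕ → Polynomial k)

/-- The variable `x` of `k[x^±1, s^±1]`. -/
def laurentX : AddMonoidAlgebra k (ℤ × ℤ) := AddMonoidAlgebra.single (1, 0) 1

/-- The variable `s` of `k[x^±1, s^±1]`. -/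
def laurentS : AddMonoidAlgebra k (ℤ × ℤ) := AddMonoidAlgebra.single (0, 1) 1

/-- The element `x⁻ⁿ P(x,s)` of `k[x^±1, s^±1]`. -/
def laurentY : AddMonoidAlgebra k (ℤ × ℤ) :=
  AddMonoidAlgebra.single (-(n : ℤ), 0) 1 * monicEval d f (laurentX k) (laurentS k)

/-- The element `x⁻ᵉ (Q(x,y) - s)` of `k[x^±1, s^±1]`, where `y = x⁻ⁿ P(x,s)`. -/
def laurentZ : AddMonoidAlgebra k (ℤ × ℤ) :=
  AddMonoidAlgebra.single (-(e : ℤ), 0) 1 *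
    (monicEval m g (laurentX k) (laurentY k n d f) - laurentS k)

variable {k}

theorem laurentX_pow_mul (N : ℕ) (w : AddMonoidAlgebra k (ℤ × ℤ)) :
    laurentX k ^ N * (AddMonoidAlgebra.single (-(N : ℤ), 0) 1 * w) = w := by
  rw [laurentX, AddMonoidAlgebra.single_pow, ← mul_assoc, AddMonoidAlgebra.single_mul_single]
  simp [← Prod.zero_eq_mk, ← AddMonoidAlgebra.one_def]

end Laurent

section Presentation

variable {k : Type*} [Field k] (n e d m : ℕ) (f g : ℕ → Polynomial k)

/-- The embedding of `R_{n,e,P,Q}` into `k[x^±1, s^±1]`. -/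
def RRing.toLaurent : RRing k n e d m f g →ₐ[k] AddMonoidAlgebra k (ℤ × ℤ) :=
  Ideal.Quotient.liftₐ (RIdeal k n e d m f g)
    (aeval ![laurentX k, laurentY k n d f, laurentZ k n e d m f g]) (by
      intro a ha
      have hle : RIdeal k n e d m f g ≤ RingHom.ker
          (aeval ![laurentX k, laurentY k n d f, laurentZ k n e d m f g]) := by
        rw [RIdeal, Ideal.span_singleton_le_iff_mem, RingHom.mem_ker]
        change aeval _ (X 0 ^ n * X 1 - monicEval d f (X 0)
          (monicEval m g (X 0) (X 1) - X 0 ^ e * X 2)) = 0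
        simp only [map_sub, map_mul, map_pow, map_monicEval, aeval_X, Matrix.cons_val_zero,
          Matrix.cons_val_one, Matrix.cons_val]
        rw [laurentZ, laurentX_pow_mul, sub_sub_cancel, laurentY, laurentX_pow_mul, sub_self]
      exact hle ha)

theorem RRing.toLaurent_mk (p : MvPolynomial (Fin 3) k) :
    RRing.toLaurent n e d m f g (Ideal.Quotient.mk _ p) =
      aeval ![laurentX k, laurentY k n d f, laurentZ k n e d m f g] p := rfl

/-- The quotient map onto `R_{n,e,P,Q}`. -/
def RRing.mkₐ : MvPolynomial (Fin 3) k →ₐ[k] RRing k n e d m f g :=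
  Ideal.Quotient.mkₐ k (RIdeal k n e d m f g)

theorem RRing.mkₐ_surjective : Function.Surjective (RRing.mkₐ (k := k) n e d m f g) :=
  Ideal.Quotient.mkₐ_surjective k (RIdeal k n e d m f g)

theorem RRing.sel_eq : sel k n e d m f g = monicEval m g (xel k n e d m f g) (yel k n e d m f g) -
    xel k n e d m f g ^ e * zel k n e d m f g := by
  change RRing.mkₐ n e d m f g (monicEval m g (X 0) (X 1) - X 0 ^ e * X 2) = _
  rw [map_sub, map_monicEval, map_mul, map_pow]
  rfl

theorem RRing.rel_y : xel k n e d m f g ^ n * yel k n e d m f g =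
    monicEval d f (xel k n e d m f g) (sel k n e d m f g) := by
  have h : RRing.mkₐ n e d m f g (X 0 ^ n * X 1) = RRing.mkₐ n e d m f g
      (monicEval d f (X 0) (Qpoly k m g - X 0 ^ e * X 2)) :=
    Ideal.Quotient.eq.2 (Ideal.mem_span_singleton_self _)
  rw [map_mul, map_pow, map_monicEval] at h
  exact h

theorem adjoin_range_fin_three {k B : Type*} [CommRing k] [CommRing B] [Algebra k B]
    (h : MvPolynomial (Fin 3) k →ₐ[k] B) :
    Algebra.adjoin k {h (X 0), h (X 1), h (X 2)} = h.range := by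
  rw [← Algebra.map_top, ← adjoin_range_X, AlgHom.map_adjoin, ← Set.range_comp]
  congr 1
  ext b
  simp [Fin.exists_fin_succ, eq_comm]

theorem RRing.isModel (hd : 2 ≤ d) (hm : 2 ≤ m) :
    IsModel n e d m f g (xel k n e d m f g) (sel k n e d m f g) (yel k n e d m f g)
      (zel k n e d m f g) (RRing.toLaurent n e d m f g) where
  two_le_d := hd
  two_le_m := hm
  adjoin_eq_top := by
    have h := adjoin_range_fin_three (RRing.mkₐ (k := k) n e d m f g)
    rw [(AlgHom.range_eq_top _).2 (RRing.mkₐ_surjective n e d m f g)] at h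
    rw [eq_top_iff, ← h]
    refine Algebra.adjoin_mono ?_
    rintro b (rfl | rfl | rfl)
    exacts [Or.inl rfl, Or.inr (Or.inr (Or.inl rfl)), Or.inr (Or.inr (Or.inr rfl))]
  rel_y := RRing.rel_y n e d m f g
  rel_z := by rw [RRing.sel_eq, sub_sub_cancel]
  map_x := by
    rw [xel, RRing.toLaurent_mk, aeval_X]
    rfl
  map_s := by
    rw [RRing.sel_eq, map_sub, map_mul, map_pow, map_monicEval, xel, yel, zel,
      RRing.toLaurent_mk, RRing.toLaurent_mk, RRing.toLaurent_mk, aeval_X, aeval_X, aeval_X]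
    change monicEval m g (laurentX k) (laurentY k n d f) - laurentX k ^ e *
      laurentZ k n e d m f g = _
    rw [laurentZ, laurentX_pow_mul, sub_sub_cancel]
    rfl

/-- The embedding of the Danielewski domain into `k[x^±1, s^±1]`. -/
def DanRing.toLaurent : DanRing k n d f →ₐ[k] AddMonoidAlgebra k (ℤ × ℤ) :=
  Ideal.Quotient.liftₐ (DanIdeal k n d f)
    (aeval ![laurentX k, laurentS k, laurentY k n d f]) (by
      intro a ha
      have hle : DanIdeal k n d f ≤ RingHom.ker
          (aeval ![laurentX k, laurentS k, laurentY k n d f]) := by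
        rw [DanIdeal, Ideal.span_singleton_le_iff_mem, RingHom.mem_ker]
        change aeval _ (X 0 ^ n * X 2 - monicEval d f (X 0) (X 1)) = 0
        simp only [map_sub, map_mul, map_pow, map_monicEval, aeval_X, Matrix.cons_val_zero,
          Matrix.cons_val_one, Matrix.cons_val]
        rw [laurentY, laurentX_pow_mul, sub_self]
      exact hle ha)

/-- The quotient map onto the Danielewski domain. -/
def DanRing.mkₐ : MvPolynomial (Fin 3) k →ₐ[k] DanRing k n d f :=
  Ideal.Quotient.mkₐ k (DanIdeal k n d f)

theorem DanRing.mkₐ_surjective : Function.Surjective (DanRing.mkₐ (k := k) n d f) :=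
  Ideal.Quotient.mkₐ_surjective k (DanIdeal k n d f)

theorem DanRing.toLaurent_mkₐ (p : MvPolynomial (Fin 3) k) :
    DanRing.toLaurent n d f (DanRing.mkₐ n d f p) =
      aeval ![laurentX k, laurentS k, laurentY k n d f] p := rfl

theorem DanRing.isModel (hd : 2 ≤ d) :
    IsModel (k := k) n 0 d 2 f 0 (DanRing.mkₐ n d f (X 0)) (DanRing.mkₐ n d f (X 1))
      (DanRing.mkₐ n d f (X 2)) (monicEval (k := k) 2 0 (DanRing.mkₐ n d f (X 0))
        (DanRing.mkₐ n d f (X 2)) - DanRing.mkₐ n d f (X 1)) (DanRing.toLaurent n d f) where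
  two_le_d := hd
  two_le_m := le_rfl
  adjoin_eq_top := by
    have h := adjoin_range_fin_three (DanRing.mkₐ (k := k) n d f)
    rw [(AlgHom.range_eq_top _).2 (DanRing.mkₐ_surjective n d f)] at h
    rw [eq_top_iff, ← h]
    refine Algebra.adjoin_mono ?_
    rintro b (rfl | rfl | rfl)
    exacts [Or.inl rfl, Or.inr (Or.inl rfl), Or.inr (Or.inr (Or.inl rfl))]
  rel_y := by
    have h : DanRing.mkₐ n d f (X 0 ^ n * X 2) = DanRing.mkₐ n d f (monicEval d f (X 0) (X 1)) :=
      Ideal.Quotient.eq.2 (Ideal.mem_span_singleton_self _)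
    rwa [map_mul, map_pow, map_monicEval] at h
  rel_z := by rw [pow_zero, one_mul]
  map_x := by rw [DanRing.toLaurent_mkₐ, aeval_X]; rfl
  map_s := by rw [DanRing.toLaurent_mkₐ, aeval_X]; rfl

/-- The canonical map from the Danielewski domain to `R_{n,e,P,Q}`. -/
def DanRing.toRRing : DanRing k n d f →ₐ[k] RRing k n e d m f g :=
  Ideal.Quotient.liftₐ (DanIdeal k n d f)
    (aeval ![xel k n e d m f g, sel k n e d m f g, yel k n e d m f g]) (by
      intro a ha
      have hle : DanIdeal k n d f ≤ RingHom.ker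
          (aeval ![xel k n e d m f g, sel k n e d m f g, yel k n e d m f g]) := by
        rw [DanIdeal, Ideal.span_singleton_le_iff_mem, RingHom.mem_ker]
        change aeval _ (X 0 ^ n * X 2 - monicEval d f (X 0) (X 1)) = 0
        simp only [map_sub, map_mul, map_pow, map_monicEval, aeval_X, Matrix.cons_val_zero,
          Matrix.cons_val_one, Matrix.cons_val]
        rw [RRing.rel_y, sub_self]
      exact hle ha)

theorem DanRing.toRRing_mkₐ (p : MvPolynomial (Fin 3) k) :
    DanRing.toRRing n e d m f g (DanRing.mkₐ n d f p) =
      aeval ![xel k n e d m f g, sel k n e d m f g, yel k n e d m f g] p := rfl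

theorem DanRing.toRRing_injective (hd : 2 ≤ d) (hm : 2 ≤ m) :
    Function.Injective (DanRing.toRRing (k := k) n e d m f g) := by
  have hR := RRing.isModel (k := k) n e d m f g hd hm
  have h : ((RRing.toLaurent n e d m f g).comp (DanRing.toRRing n e d m f g)).comp
      (DanRing.mkₐ n d f) = (DanRing.toLaurent n d f).comp (DanRing.mkₐ n d f) := by
    refine MvPolynomial.algHom_ext fun i => ?_
    rw [AlgHom.comp_apply, AlgHom.comp_apply, AlgHom.comp_apply, DanRing.toRRing_mkₐ,
      DanRing.toLaurent_mkₐ, aeval_X, aeval_X]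
    fin_cases i
    · exact hR.map_x
    · exact hR.map_s
    · change RRing.toLaurent n e d m f g (yel k n e d m f g) = laurentY k n d f
      rw [yel, RRing.toLaurent_mk, aeval_X]
      rfl
  intro a b hab
  obtain ⟨a, rfl⟩ := DanRing.mkₐ_surjective n d f a
  obtain ⟨b, rfl⟩ := DanRing.mkₐ_surjective n d f b
  refine (DanRing.isModel n d f hd).injective ?_
  have ha := DFunLike.congr_fun h a
  rw [AlgHom.comp_apply, AlgHom.comp_apply, hab] at ha
  exact ha.symm.trans (DFunLike.congr_fun h b)

theorem DanRing.range_toRRing : (DanRing.toRRing (k := k) n e d m f g).range =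
    Algebra.adjoin k {xel k n e d m f g, sel k n e d m f g, yel k n e d m f g} := by
  have h := adjoin_range_fin_three
    ((DanRing.toRRing (k := k) n e d m f g).comp (DanRing.mkₐ n d f))
  simp only [AlgHom.comp_apply, DanRing.toRRing_mkₐ, aeval_X] at h
  rw [AlgHom.range_comp, (AlgHom.range_eq_top _).2 (DanRing.mkₐ_surjective n d f),
    Algebra.map_top] at h
  exact h.symm

end Presentation

end

theorem stmt13 {k : Type*} [Field k] [CharZero k]
    (n e d m : ℕ) (hn : 1 ≤ n) (hne : ¬(n = 1 ∧ e = 0)) (hd : 2 ≤ d) (hm : 2 ≤ m)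
    (f g : ℕ → Polynomial k) :
    -- the subalgebra `k[x,s,y]` is isomorphic to the Danielewski domain `B_{n,P}`
    Nonempty ((Algebra.adjoin k
        {xel k n e d m f g, sel k n e d m f g, yel k n e d m f g}) ≃ₐ[k] DanRing k n d f) ∧
    ∀ D : Derivation k (RRing k n e d m f g) (RRing k n e d m f g),
      IsLND D → D ≠ 0 →
      -- `D` maps `k[x,s,y]` into itself and its restriction is nonzero
      ((∀ w ∈ Algebra.adjoin k {xel k n e d m f g, sel k n e d m f g, yel k n e d m f g},
          D w ∈ Algebra.adjoin k {xel k n e d m f g, sel k n e d m f g, yel k n e d m f g}) ∧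
        (∃ w ∈ Algebra.adjoin k {xel k n e d m f g, sel k n e d m f g, yel k n e d m f g},
          D w ≠ 0)) ∧
      -- `D` maps `k[x,s]` into itself and its restriction is nonzero
      ((∀ w ∈ Algebra.adjoin k {xel k n e d m f g, sel k n e d m f g},
          D w ∈ Algebra.adjoin k {xel k n e d m f g, sel k n e d m f g}) ∧
        (∃ w ∈ Algebra.adjoin k {xel k n e d m f g, sel k n e d m f g}, D w ≠ 0)) := by
  have hR := RRing.isModel (k := k) n e d m f g hd hm
  refine ⟨⟨((AlgEquiv.ofInjective _ (DanRing.toRRing_injective n e d m f g hd hm)).trans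
    (Subalgebra.equivOfEq _ _ (DanRing.range_toRRing n e d m f g))).symm⟩, fun D hD hD0 => ?_⟩
  exact ⟨⟨fun w hw => hR.derivation_mem_adjoin_triple hn hne hD hD0 hw,
      ⟨_, Algebra.subset_adjoin (by simp), hR.derivation_s_ne_zero hn hne hD hD0⟩⟩,
    ⟨fun w hw => hR.derivation_mem_adjoin_pair hn hne hD hD0 hw,
      ⟨_, Algebra.subset_adjoin (by simp), hR.derivation_s_ne_zero hn hne hD hD0⟩⟩⟩
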